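/- arXiv:2507.13049 — 3 statements merged into one kernel-verified Lean document; each statement's English description precedes it below -/
import Mathlib

section
/- Let E be a real Banach space, let d ≥ 1, let F : E → ℝ^d be a map of class C¹, let Y ∈ E, and let Y₁, …, Y_d ∈ E be such that dF(Y)Y₁, …, dF(Y)Y_d form a basis of ℝ^d. Then for every r > 0 there exists ε > 0 such that for every Z ∈ E with ‖Z − Y‖ < ε there exists α = (α₁, …, α_d) ∈ ℝ^d with |α_i| < r for all i, such that F(Z + α₁Y₁ + ⋯ + α_d Y_d) = F(Y) and the Fréchet derivative of F at Z + α₁Y₁ + ⋯ + α_d Y_d is surjective. -/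
open Filter Topology in
/-- If `F` is `C¹` and `dF(Y)` restricted along `A : G →L[ℝ] E` is invertible, then the fiber of `F`
through `Y` meets the slice `Z + range A` for `Z` near `Y`, at points where `dF` restricted
along `A` is still invertible, and which depend continuously on `Z` at `Y`. -/
theorem ContDiff.exists_tendsto_eventually_apply_add_eq_and_isInvertible
    {E G H : Type*} [NormedAddCommGroup E] [NormedSpace ℝ E] [CompleteSpace E]
    [NormedAddCommGroup G] [NormedSpace ℝ G] [CompleteSpace G]
    [NormedAddCommGroup H] [NormedSpace ℝ H] [CompleteSpace H]
    {F : E → H} (hF : ContDiff ℝ 1 F) {Y : E} {A : G →L[ℝ] E}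
    (hA : (fderiv ℝ F Y ∘L A).IsInvertible) :
    ∃ ψ : E → G, Tendsto ψ (𝓝 Y) (𝓝 0) ∧
      ∀ᶠ Z in 𝓝 Y, F (Z + A (ψ Z)) = F Y ∧ (fderiv ℝ F (Z + A (ψ Z)) ∘L A).IsInvertible := by
  let S : E × G →L[ℝ] E := (ContinuousLinearMap.id ℝ E).coprod A
  have hS : S (Y, 0) = Y := by simp [S]
  have hstrict : HasStrictFDerivAt (F ∘ S) (fderiv ℝ F Y ∘L S) (Y, 0) := by
    refine HasStrictFDerivAt.comp _ ?_ S.hasStrictFDerivAt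
    rw [hS]
    exact hF.contDiffAt.hasStrictFDerivAt one_ne_zero
  have hinv : ((fderiv ℝ F Y ∘L S) ∘L .inr ℝ E G).IsInvertible := by
    convert hA using 1
    ext
    simp [S]
  let ψ := hstrict.implicitFunctionOfProdDomain hinv
  have hψ : Tendsto ψ (𝓝 Y) (𝓝 0) := hstrict.tendsto_implicitFunctionOfProdDomain hinv
  have hadd : Tendsto (fun Z => Z + A (ψ Z)) (𝓝 Y) (𝓝 Y) := by
    simpa using tendsto_id.add ((A.continuous.tendsto 0).comp hψ)
  have hderiv : Continuous fun X => fderiv ℝ F X ∘L A :=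
    (hF.continuous_fderiv one_ne_zero).clm_comp continuous_const
  refine ⟨ψ, hψ, .and ?_ ?_⟩
  · simpa [S] using hstrict.eventually_apply_implicitFunctionOfProdDomain hinv
  · exact ((hderiv.tendsto Y).comp hadd).eventually (ContinuousLinearEquiv.isOpen.mem_nhds hA)

/-- Degree-theoretic perturbation step: let `E` be a real Banach space, `F : E → ℝ^d`
of class `C¹` (`d ≥ 1`), `Y ∈ E`, and `Y₁, …, Y_d ∈ E` be such that
`dF(Y)Y₁, …, dF(Y)Y_d` is a basis of `ℝ^d`. Then for every `r > 0` there is `ε > 0`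
such that every `Z` with `‖Z − Y‖ < ε` admits `α ∈ ℝ^d` with `|α_i| < r` for all `i`,
`F(Z + ∑ α_i Y_i) = F(Y)`, and `F` a submersion at `Z + ∑ α_i Y_i`. -/
theorem exists_fiber_point_with_surjective_differential_near
    (E : Type*) [NormedAddCommGroup E] [NormedSpace ℝ E] [CompleteSpace E]
    (d : ℕ) (hd : 1 ≤ d)
    (F : E → EuclideanSpace ℝ (Fin d)) (hF : ContDiff ℝ 1 F)
    (Y : E) (Yv : Fin d → E)
    (hindep : LinearIndependent ℝ (fun i => fderiv ℝ F Y (Yv i)))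
    (hspan : Submodule.span ℝ (Set.range fun i => fderiv ℝ F Y (Yv i)) = ⊤) :
    ∀ r : ℝ, 0 < r → ∃ ε : ℝ, 0 < ε ∧ ∀ Z : E, ‖Z - Y‖ < ε →
      ∃ α : Fin d → ℝ, (∀ i, |α i| < r) ∧
        F (Z + ∑ i, α i • Yv i) = F Y ∧
        Function.Surjective (fderiv ℝ F (Z + ∑ i, α i • Yv i)) := by
  intro r hr
  let b := Module.Basis.mk hindep hspan.ge
  let A : (Fin d → ℝ) →L[ℝ] E := (Fintype.linearCombination ℝ Yv).toContinuousLinearMap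
  have hA_apply (α : Fin d → ℝ) : A α = ∑ i, α i • Yv i := Fintype.linearCombination_apply ..
  have hA : (fderiv ℝ F Y ∘L A).IsInvertible := by
    refine ⟨b.equivFun.symm.toContinuousLinearEquiv, ContinuousLinearMap.ext fun α => ?_⟩
    simp [hA_apply, b, Module.Basis.equivFun_symm_apply]
  obtain ⟨ψ, hψ, hfiber⟩ := hF.exists_tendsto_eventually_apply_add_eq_and_isInvertible hA
  obtain ⟨ε, hε, hball⟩ := Metric.eventually_nhds_iff.mp
    (hfiber.and (hψ.eventually (Metric.ball_mem_nhds 0 hr)))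
  refine ⟨ε, hε, fun Z hZ => ?_⟩
  obtain ⟨⟨hFZ, hinv⟩, hsmall⟩ := hball (dist_eq_norm Z Y ▸ hZ)
  rw [hA_apply] at hFZ hinv
  refine ⟨ψ Z, fun i => ?_, hFZ, .of_comp (g := A) hinv.surjective⟩
  exact (norm_le_pi_norm (ψ Z) i).trans_lt (mem_ball_zero_iff.mp hsmall)
end

section
/- Let Γ² : ℝ² × ℝ² → ℝ³ be the bi-exponential map of the Heisenberg group, Γ²((a₁,b₁),(a₂,b₂)) = exp(a₂,b₂)·exp(a₁,b₁) = (a₁ + a₂, b₁ + b₂, (a₂b₁ − a₁b₂)/2). Then for every X = (a,b) ∈ ℝ², the Fréchet derivative of Γ² at the diagonal point (X, X) is surjective onto ℝ³ if and only if X ≠ 0. -/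
noncomputable section

/-- The Heisenberg group product on `ℝ³`:
`(x,y,z)·(x',y',z') = (x + x', y + y', z + z' + (x y' − x' y)/2)`. -/
def hmul (p q : ℝ × ℝ × ℝ) : ℝ × ℝ × ℝ :=
  (p.1 + q.1, p.2.1 + q.2.1, p.2.2 + q.2.2 + (p.1 * q.2.1 - q.1 * p.2.1) / 2)

/-- The exponential of a horizontal vector: `exp(a,b) = (a,b,0)`. -/
def hexp (v : ℝ × ℝ) : ℝ × ℝ × ℝ := (v.1, v.2, 0)

/-- The bi-exponential map of the Heisenberg group:
`Γ²((a₁,b₁),(a₂,b₂)) = exp(a₂,b₂)·exp(a₁,b₁) = (a₁+a₂, b₁+b₂, (a₂b₁ − a₁b₂)/2)`. -/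
def Γ2 (Y : (ℝ × ℝ) × (ℝ × ℝ)) : ℝ × ℝ × ℝ := hmul (hexp Y.2) (hexp Y.1)

/-- The derivative of the bi-exponential map, in coordinates. -/
theorem fderiv_Γ2_apply (Y V : (ℝ × ℝ) × (ℝ × ℝ)) :
    fderiv ℝ Γ2 Y V = (V.2.1 + V.1.1, V.2.2 + V.1.2,
      (Y.2.1 * V.1.2 + Y.1.2 * V.2.1 - (Y.1.1 * V.2.2 + Y.2.2 * V.1.1)) / 2) := by
  have h₁ := hasFDerivAt_fst (𝕜 := ℝ) (p := Y)
  have h₂ := hasFDerivAt_snd (𝕜 := ℝ) (p := Y)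
  have h := (h₂.fst.add h₁.fst).prodMk ((h₂.snd.add h₁.snd).prodMk
    (((h₂.fst.mul h₁.snd).sub (h₁.fst.mul h₂.snd)).mul_const (2⁻¹ : ℝ)))
  have hΓ : Γ2 = fun Z : (ℝ × ℝ) × (ℝ × ℝ) => (Z.2.1 + Z.1.1, Z.2.2 + Z.1.2,
      (Z.2.1 * Z.1.2 - Z.1.1 * Z.2.2) * 2⁻¹) := by
    funext Z
    simp [Γ2, hmul, hexp, div_eq_mul_inv]
  rw [hΓ]
  refine (DFunLike.congr_fun h.fderiv V).trans ?_
  ext <;> simp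
  ring

/-- The Fréchet derivative of `Γ²` at the diagonal point `(X,X)` is surjective onto `ℝ³`
if and only if `X ≠ 0`. -/
theorem Γ2_submersion_at_diagonal_iff (X : ℝ × ℝ) :
    Function.Surjective (fderiv ℝ Γ2 (X, X)) ↔ X ≠ 0 := by
  constructor
  · rintro h rfl
    obtain ⟨V, hV⟩ := h (0, 0, 1)
    rw [fderiv_Γ2_apply] at hV
    simp at hV
  · rintro hX ⟨p, q, r⟩
    obtain ⟨a, b⟩ := X
    have hn : a ^ 2 + b ^ 2 ≠ 0 := by
      intro h
      apply hX
      have ha : a = 0 := by nlinarith [sq_nonneg a, sq_nonneg b]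
      have hb : b = 0 := by nlinarith [sq_nonneg a, sq_nonneg b]
      simp [ha, hb]
    refine ⟨((p / 2 - r * b / (a ^ 2 + b ^ 2), q / 2 + r * a / (a ^ 2 + b ^ 2)),
      (p / 2 + r * b / (a ^ 2 + b ^ 2), q / 2 - r * a / (a ^ 2 + b ^ 2))), ?_⟩
    rw [fderiv_Γ2_apply]
    ext
    · ring
    · ring
    · field_simp
      ring
end
end

section
/- In the Heisenberg group, every horizontal vector satisfies the strong (H)-condition: for every X ∈ ℝ² and every η > 0, there exist an integer p ≥ 2 and vectors W₁, …, W_p ∈ ℝ² such that ‖W_i − X‖ < η for all i, Γ^p(W₁, …, W_p) = Γ^p(X, …, X), and the Fréchet derivative of Γ^p at (W₁, …, W_p) is surjective onto ℝ³. -/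
noncomputable section

/-- The multiexponential map `Γ^p(Y₁,…,Y_p) = exp(Y_p)·⋯·exp(Y₁)`. -/
def Γmulti (p : ℕ) (Y : Fin p → ℝ × ℝ) : ℝ × ℝ × ℝ :=
  ((List.finRange p).reverse.map (fun i => hexp (Y i))).foldl hmul ((0, 0, 0) : ℝ × ℝ × ℝ)

/-- The symplectic form on `ℝ²` that drives the vertical coordinate of the Heisenberg group. -/
def symp (v w : ℝ × ℝ) : ℝ := v.1 * w.2 - w.1 * v.2

lemma Γmulti_three (Y : Fin 3 → ℝ × ℝ) :
    Γmulti 3 Y = ((Y 0).1 + (Y 1).1 + (Y 2).1, (Y 0).2 + (Y 1).2 + (Y 2).2,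
      (symp (Y 2) (Y 1) + symp (Y 2) (Y 0) + symp (Y 1) (Y 0)) / 2) := by
  simp only [Γmulti, List.finRange_succ, List.finRange_zero, List.map_cons, List.map_nil,
    List.reverse_cons, List.reverse_nil, List.nil_append, List.cons_append, List.foldl_cons,
    List.foldl_nil, hmul, hexp, symp, Fin.succ_zero_eq_one, Fin.succ_one_eq_two, Prod.mk.injEq]
  refine ⟨?_, ?_, ?_⟩ <;> ring

lemma differentiable_Γmulti_three : Differentiable ℝ (Γmulti 3) := by
  rw [funext Γmulti_three]
  unfold symp
  fun_prop

/-- The derivative is computed along lines, on which `Γ³` is a quadratic polynomial. -/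
lemma fderiv_Γmulti_three (W V : Fin 3 → ℝ × ℝ) :
    fderiv ℝ (Γmulti 3) W V =
      ((V 0).1 + (V 1).1 + (V 2).1, (V 0).2 + (V 1).2 + (V 2).2,
        (symp (V 2) (W 1) + symp (W 2) (V 1) + (symp (V 2) (W 0) + symp (W 2) (V 0))
          + (symp (V 1) (W 0) + symp (W 1) (V 0))) / 2) := by
  have hline : HasDerivAt (fun t : ℝ => Γmulti 3 (W + t • V)) (fderiv ℝ (Γmulti 3) W V) 0 :=
    (differentiable_Γmulti_three W).hasFDerivAt.hasLineDerivAt V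
  have haffine (a b : ℝ) : HasDerivAt (fun t : ℝ => a + t * b) b 0 := by
    simpa using ((hasDerivAt_id (0 : ℝ)).mul_const b).const_add a
  have hsymp (p q v w : ℝ × ℝ) :
      HasDerivAt (fun t : ℝ => symp (p + t • v) (q + t • w)) (symp v q + symp p w) 0 := by
    refine (((haffine p.1 v.1).mul (haffine q.2 w.2)).sub
      ((haffine q.1 w.1).mul (haffine p.2 v.2))).congr_deriv ?_
    simp only [symp]
    ring
  refine hline.unique ?_
  simp only [Γmulti_three, Pi.add_apply, Pi.smul_apply]
  exact (((haffine _ _).add (haffine _ _)).add (haffine _ _)).prodMk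
    ((((haffine _ _).add (haffine _ _)).add (haffine _ _)).prodMk
      ((((hsymp _ _ _ _).add (hsymp _ _ _ _)).add (hsymp _ _ _ _)).div_const 2))

/-- In the Heisenberg group, every horizontal vector satisfies the strong
(H)-condition: for every `X ∈ ℝ²` and every `η > 0` there exist `p ≥ 2` and
`W₁,…,W_p ∈ ℝ²` with `‖W_i − X‖ < η` for all `i`,
`Γ^p(W₁,…,W_p) = Γ^p(X,…,X)`, and `Γ^p` a submersion at `(W₁,…,W_p)`. -/
theorem heisenberg_strong_H_condition (X : ℝ × ℝ) :
    ∀ η : ℝ, 0 < η →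
      ∃ p : ℕ, 2 ≤ p ∧ ∃ W : Fin p → ℝ × ℝ,
        (∀ i, ‖W i - X‖ < η) ∧
        Γmulti p W = Γmulti p (fun _ => X) ∧
        Function.Surjective (fderiv ℝ (Γmulti p) W) := by
  intro η hη
  obtain ⟨ε, hε, hεη, hne⟩ : ∃ ε : ℝ, 0 < ε ∧ 2 * ε < η ∧ 2 * X.1 - ε ≠ 0 := by
    by_cases h : 2 * X.1 - η / 4 = 0
    · exact ⟨η / 8, by linarith, by linarith, fun h' => by linarith⟩
    · exact ⟨η / 4, by linarith, by linarith, h⟩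
  refine ⟨3, by norm_num, ![X + (ε, 0), X - (2 * ε, 0), X + (ε, 0)], ?_, ?_, ?_⟩
  · intro i
    fin_cases i <;> simp [Prod.norm_def, abs_of_pos hε, hη] <;> linarith
  · simp only [Γmulti_three, symp, Matrix.cons_val, Prod.fst_add, Prod.snd_add, Prod.fst_sub,
      Prod.snd_sub, Prod.mk.injEq]
    refine ⟨?_, ?_, ?_⟩ <;> ring
  · rintro ⟨a, b, c⟩
    obtain ⟨s, hs⟩ : ∃ s, (2 * X.1 - ε) * s = 2 * c := ⟨_, mul_div_cancel₀ (2 * c) hne⟩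
    refine ⟨![(0, s), (a, b - s), 0], ?_⟩
    simp only [fderiv_Γmulti_three, symp, Matrix.cons_val, Prod.fst_add, Prod.snd_add,
      Prod.fst_sub, Prod.snd_sub, Prod.fst_zero, Prod.snd_zero, Prod.mk.injEq]
    refine ⟨by ring, by ring, ?_⟩
    linear_combination hs / 2
end
end
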